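/- arXiv:1409.4649 — 5 statements merged into one kernel-verified Lean document; each statement's English description precedes it below -/
import Mathlib

section
/- Let M_alpha and M_beta be Hausdorff topological spaces equipped with flows phi_alpha and phi_beta, let h : M_alpha -> M_beta be a flow map, let N_beta be an isolating neighborhood for phi_beta, and set N_alpha := h^{-1}(N_beta). Then h is an isolated map with respect to N_alpha and N_beta: every p in N_alpha with O_-(p) contained in N_alpha and O_+(h(p)) contained in N_beta satisfies O_-(p) contained in the interior of N_alpha and O_+(h(p)) contained in the interior of N_beta. -/
open Set

/-- A flow on a topological space `M`: a continuous map `ℝ × M → M` with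
`φ 0 x = x` and `φ (t+s) x = φ t (φ s x)`. -/
def IsFlow {M : Type*} [TopologicalSpace M] (φ : ℝ → M → M) : Prop :=
  Continuous (fun q : ℝ × M => φ q.1 q.2) ∧ (∀ x, φ 0 x = x) ∧
    (∀ t s x, φ (t + s) x = φ t (φ s x))

/-- The maximal invariant set `Inv(N, φ)` inside `N`. -/
def maxInv {M : Type*} (φ : ℝ → M → M) (N : Set M) : Set M :=
  {x | x ∈ N ∧ ∀ t : ℝ, φ t x ∈ N}

/-- `N` is an isolating neighborhood for the flow `φ`. -/
def IsIsolatingNbhd {M : Type*} [TopologicalSpace M] (φ : ℝ → M → M) (N : Set M) : Prop :=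
  IsCompact N ∧ maxInv φ N ⊆ interior N

/-- The backward orbit `O₋(p) = {φ t p | t ≤ 0}`. -/
def backOrbit {M : Type*} (φ : ℝ → M → M) (p : M) : Set M :=
  {q | ∃ t ≤ (0 : ℝ), φ t p = q}

/-- The forward orbit `O₊(p) = {φ t p | t ≥ 0}`. -/
def fwdOrbit {M : Type*} (φ : ℝ → M → M) (p : M) : Set M :=
  {q | ∃ t ≥ (0 : ℝ), φ t p = q}

/-- A flow map: a continuous proper equivariant map. -/
def IsFlowMap {Mα Mβ : Type*} [TopologicalSpace Mα] [TopologicalSpace Mβ]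
    (φα : ℝ → Mα → Mα) (φβ : ℝ → Mβ → Mβ) (h : Mα → Mβ) : Prop :=
  Continuous h ∧ (∀ K : Set Mβ, IsCompact K → IsCompact (h ⁻¹' K)) ∧
    (∀ (t : ℝ) (p : Mα), h (φα t p) = φβ t (h p))

/-- `h` is an isolated map with respect to the isolating neighborhoods `Nα`, `Nβ`. -/
def IsIsolatedMap {Mα Mβ : Type*} [TopologicalSpace Mα] [TopologicalSpace Mβ]
    (φα : ℝ → Mα → Mα) (φβ : ℝ → Mβ → Mβ) (Nα : Set Mα) (Nβ : Set Mβ)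
    (h : Mα → Mβ) : Prop :=
  ∀ p ∈ Nα, backOrbit φα p ⊆ Nα → fwdOrbit φβ (h p) ⊆ Nβ →
    backOrbit φα p ⊆ interior Nα ∧ fwdOrbit φβ (h p) ⊆ interior Nβ

/-- The maximal invariant set contains the whole orbit of each of its points. -/
theorem IsFlow.map_mem_maxInv {M : Type*} [TopologicalSpace M] {φ : ℝ → M → M}
    (hφ : IsFlow φ) {N : Set M} {x : M} (hx : x ∈ maxInv φ N) (t : ℝ) :
    φ t x ∈ maxInv φ N :=
  ⟨hx.2 t, fun s => hφ.2.2 s t x ▸ hx.2 (s + t)⟩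

/-- a flow map is isolated with respect to `h⁻¹(Nβ)` and `Nβ`. -/
theorem flowMap_isIsolatedMap
    {Mα Mβ : Type*} [TopologicalSpace Mα] [TopologicalSpace Mβ] [T2Space Mα] [T2Space Mβ]
    (φα : ℝ → Mα → Mα) (φβ : ℝ → Mβ → Mβ) (hφα : IsFlow φα) (hφβ : IsFlow φβ)
    (h : Mα → Mβ) (hfm : IsFlowMap φα φβ h)
    (Nβ : Set Mβ) (hNβ : IsIsolatingNbhd φβ Nβ) :
    IsIsolatedMap φα φβ (h ⁻¹' Nβ) Nβ h := by
  obtain ⟨hcont, -, hequiv⟩ := hfm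
  intro p hp hback hfwd
  have hmem : h p ∈ maxInv φβ Nβ := by
    refine ⟨hp, fun t => ?_⟩
    rcases le_total t 0 with ht | ht
    · exact hequiv t p ▸ hback ⟨t, ht, rfl⟩
    · exact hfwd ⟨t, ht, rfl⟩
  have hint (t : ℝ) : φβ t (h p) ∈ interior Nβ := hNβ.2 (hφβ.map_mem_maxInv hmem t)
  constructor
  · rintro _ ⟨t, -, rfl⟩
    refine preimage_interior_subset_interior_preimage hcont ?_
    rw [mem_preimage, hequiv]
    exact hint t
  · rintro _ ⟨t, -, rfl⟩
    exact hint t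
end

section
/- Let h : M_alpha -> M_beta be a flow map between Hausdorff spaces with flows phi_alpha, phi_beta, and let S_beta be an isolated invariant set for phi_beta with isolating neighborhood N_beta. Then S_alpha := h^{-1}(S_beta) is an isolated invariant set for phi_alpha, with isolating neighborhood h^{-1}(N_beta); in particular phi_alpha(t, S_alpha) = S_alpha for all t in R. -/
open Set

theorem maxInv_preimage {M M' : Type*} {φ : ℝ → M → M} {ψ : ℝ → M' → M'} {h : M → M'}
    (heq : ∀ t p, h (φ t p) = ψ t (h p)) (N : Set M') :
    maxInv φ (h ⁻¹' N) = h ⁻¹' maxInv ψ N := by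
  ext x
  simp [maxInv, heq]

theorem IsIsolatingNbhd.preimage {M M' : Type*} [TopologicalSpace M] [TopologicalSpace M']
    {φ : ℝ → M → M} {ψ : ℝ → M' → M'} {h : M → M'} {N : Set M'}
    (hN : IsIsolatingNbhd ψ N) (hh : IsFlowMap φ ψ h) : IsIsolatingNbhd φ (h ⁻¹' N) := by
  refine ⟨hh.2.1 N hN.1, ?_⟩
  rw [maxInv_preimage hh.2.2]
  exact (preimage_mono hN.2).trans (preimage_interior_subset_interior_preimage hh.1)

theorem IsFlow.image_maxInv {M : Type*} [TopologicalSpace M] {φ : ℝ → M → M}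
    (hφ : IsFlow φ) (N : Set M) (t : ℝ) : φ t '' maxInv φ N = maxInv φ N := by
  obtain ⟨-, hzero, hadd⟩ := hφ
  have hmem : ∀ s, ∀ x ∈ maxInv φ N, φ s x ∈ maxInv φ N := fun s x hx =>
    ⟨hx.2 s, fun r => hadd r s x ▸ hx.2 (r + s)⟩
  refine Subset.antisymm (image_subset_iff.2 fun x => hmem t x) fun x hx =>
    ⟨φ (-t) x, hmem _ x hx, ?_⟩
  rw [← hadd, add_neg_cancel, hzero]

/-- the preimage of an isolated invariant set under a flow map is an
isolated invariant set, with isolating neighborhood the preimage of the isolating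
neighborhood; in particular it is invariant. -/
theorem flowMap_preimage_isolatedInvariantSet
    {Mα Mβ : Type*} [TopologicalSpace Mα] [TopologicalSpace Mβ] [T2Space Mα] [T2Space Mβ]
    (φα : ℝ → Mα → Mα) (φβ : ℝ → Mβ → Mβ) (hφα : IsFlow φα) (hφβ : IsFlow φβ)
    (h : Mα → Mβ) (hfm : IsFlowMap φα φβ h)
    (Nβ : Set Mβ) (hNβ : IsIsolatingNbhd φβ Nβ)
    (Sβ : Set Mβ) (hSβinv : ∀ t : ℝ, φβ t '' Sβ = Sβ) (hSβ : Sβ = maxInv φβ Nβ) :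
    IsIsolatingNbhd φα (h ⁻¹' Nβ) ∧ h ⁻¹' Sβ = maxInv φα (h ⁻¹' Nβ) ∧
      (∀ t : ℝ, φα t '' (h ⁻¹' Sβ) = h ⁻¹' Sβ) := by
  have hS : h ⁻¹' Sβ = maxInv φα (h ⁻¹' Nβ) := by rw [hSβ, maxInv_preimage hfm.2.2]
  refine ⟨hNβ.preimage hfm, hS, fun t => ?_⟩
  rw [hS, hφα.image_maxInv]
end

section
/- Let h : M_alpha -> M_beta be a flow map between Hausdorff spaces with flows phi_alpha, phi_beta. Let S_beta be an isolated invariant set for phi_beta with isolating neighborhood N_beta, and let f_beta : M_beta -> R be a Lyapunov function for (S_beta, phi_beta) on N_beta. Set N_alpha = h^{-1}(N_beta) and S_alpha = Inv(N_alpha, phi_alpha). Then f_alpha := f_beta ∘ h is a Lyapunov function for (S_alpha, phi_alpha) on N_alpha: f_alpha is constant on S_alpha, and for every p in N_alpha \ S_alpha the function t ↦ f_alpha(phi_alpha(t,p)) is differentiable at t = 0 with strictly negative derivative. -/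
open Set

/-- the pullback of a Lyapunov function along a flow map is a Lyapunov
function for the pulled-back isolated invariant set. -/
theorem flowMap_pullback_lyapunov
    {Mα Mβ : Type*} [TopologicalSpace Mα] [TopologicalSpace Mβ] [T2Space Mα] [T2Space Mβ]
    (φα : ℝ → Mα → Mα) (φβ : ℝ → Mβ → Mβ) (hφα : IsFlow φα) (hφβ : IsFlow φβ)
    (h : Mα → Mβ) (hfm : IsFlowMap φα φβ h)
    (Nβ : Set Mβ) (hNβ : IsIsolatingNbhd φβ Nβ)
    (fβ : Mβ → ℝ)
    (hconst : ∀ x ∈ maxInv φβ Nβ, ∀ y ∈ maxInv φβ Nβ, fβ x = fβ y)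
    (hlyap : ∀ p ∈ Nβ \ maxInv φβ Nβ,
      ∃ d < (0 : ℝ), HasDerivAt (fun t : ℝ => fβ (φβ t p)) d 0) :
    (∀ x ∈ maxInv φα (h ⁻¹' Nβ), ∀ y ∈ maxInv φα (h ⁻¹' Nβ), (fβ ∘ h) x = (fβ ∘ h) y) ∧
      (∀ p ∈ (h ⁻¹' Nβ) \ maxInv φα (h ⁻¹' Nβ),
        ∃ d < (0 : ℝ), HasDerivAt (fun t : ℝ => (fβ ∘ h) (φα t p)) d 0) := by
  have hmem : ∀ p, p ∈ maxInv φα (h ⁻¹' Nβ) ↔ h p ∈ maxInv φβ Nβ := fun p => by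
    simp only [maxInv, mem_ofPred_eq, mem_preimage, hfm.2.2]
  refine ⟨fun x hx y hy => hconst _ ((hmem x).1 hx) _ ((hmem y).1 hy), fun p hp => ?_⟩
  simpa only [Function.comp_apply, hfm.2.2] using
    hlyap (h p) ⟨hp.1, fun hq => hp.2 ((hmem p).2 hq)⟩
end

section
/- Let M_alpha, M_beta be locally compact Hausdorff spaces, and let N_alpha ⊆ M_alpha, N_beta ⊆ M_beta be compact subsets. Give the product space C(R x M_alpha, M_alpha) x C(M_alpha, M_beta) x C(R x M_beta, M_beta) of continuous maps the product of compact-open topologies, and let 𝒞 be the subspace of triples (phi_alpha', h', phi_beta') such that phi_alpha' and phi_beta' are flows and N_alpha, N_beta are isolating neighborhoods for phi_alpha' and phi_beta' respectively. If (phi_alpha, h, phi_beta) lies in 𝒞 and h is isolated with respect to N_alpha, N_beta (for the flows phi_alpha, phi_beta), then there is an open neighborhood A of (phi_alpha, h, phi_beta) in 𝒞 such that for every (phi_alpha', h', phi_beta') in A the map h' is isolated with respect to N_alpha, N_beta (for the flows phi_alpha', phi_beta'). In other words, the set of isolated triples is open in 𝒞. -/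
open Set

open Filter Topology

/-- If maps `Φ x` converge to `φ`, points `p x` converge to `p₀`, and each point `p x` moves under
`Φ x` from time `0` in the direction of `ε` inside a closed set `N`, then so does `p₀` under `φ`. -/
theorem ray_mem_of_tendsto {X M : Type*} [TopologicalSpace M]
    [LocallyCompactSpace M] {l : Filter X} [l.NeBot] {Φ : X → C(ℝ × M, M)} {φ : C(ℝ × M, M)}
    (hΦ : Tendsto Φ l (𝓝 φ)) {p : X → M} {p₀ : M} (hp : Tendsto p l (𝓝 p₀)) {N : Set M}
    (hN : IsClosed N) (ε : ℝ) (hray : ∀ᶠ x in l, ∀ s ≥ (0 : ℝ), Φ x (ε * s, p x) ∈ N) :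
    ∀ s ≥ (0 : ℝ), φ (ε * s, p₀) ∈ N := fun s hs =>
  hN.mem_of_tendsto (hΦ.eval (tendsto_const_nhds.prodMk_nhds hp))
    (hray.mono fun _ hx => hx s hs)

/-- If half-orbits of flows `Φ x` converging to `φ` stay in `N` but leave its interior, then so does
the limiting half-orbit, provided that `N` isolates its maximal invariant set under `φ`. -/
theorem exists_ray_notMem_interior_of_tendsto {X M : Type*} [TopologicalSpace M]
    [LocallyCompactSpace M] [T2Space M] {U : Ultrafilter X}
    {Φ : X → C(ℝ × M, M)} {φ : C(ℝ × M, M)} (hΦ : Tendsto Φ U (𝓝 φ))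
    (hadd : ∀ x t s y, Φ x (t + s, y) = Φ x (t, Φ x (s, y)))
    {p : X → M} {p₀ : M} (hp : Tendsto p U (𝓝 p₀)) {N : Set M} (hN : IsCompact N)
    (hinv : maxInv (fun t x => φ (t, x)) N ⊆ interior N) {ε : ℝ} (hε : ε ≠ 0)
    (hray : ∀ᶠ x in U, ∀ s ≥ (0 : ℝ), Φ x (ε * s, p x) ∈ N)
    (hout : ∀ᶠ x in U, ∃ s ≥ (0 : ℝ), Φ x (ε * s, p x) ∉ interior N) :
    ∃ s ≥ (0 : ℝ), φ (ε * s, p₀) ∉ interior N := by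
  obtain ⟨t, ht⟩ := hout.choice
  by_cases hbdd : ∃ C, ∀ᶠ x in U, t x ≤ C
  · obtain ⟨C, hC⟩ := hbdd
    obtain ⟨t₀, ht₀, htU⟩ := (isCompact_Icc (a := (0 : ℝ)) (b := C)).ultrafilter_le_nhds
      (U.map t) (le_principal_iff.2 (by
        exact (hC.and ht).mono fun x hx => ⟨hx.2.1, hx.1⟩))
    have htU : Tendsto t U (𝓝 t₀) := htU
    exact ⟨t₀, ht₀.1, isOpen_interior.isClosed_compl.mem_of_tendsto
      (hΦ.eval ((htU.const_mul ε).prodMk_nhds hp)) (ht.mono fun _ hx => hx.2)⟩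
  · exfalso
    rw [not_exists] at hbdd
    have hlarge : ∀ C, ∀ᶠ x in U, C < t x := fun C => by
      simpa only [not_le] using Ultrafilter.eventually_not.2 (hbdd C)
    obtain ⟨q, hq, hqU⟩ := hN.ultrafilter_le_nhds (U.map fun x => Φ x (ε * t x, p x))
      (le_principal_iff.2 (by
        exact (hray.and ht).mono fun x hx => hx.1 _ hx.2.1))
    have hqU : Tendsto (fun x => Φ x (ε * t x, p x)) U (𝓝 q) := hqU
    have hqi : q ∉ interior N := isOpen_interior.isClosed_compl.mem_of_tendsto hqU
      (ht.mono fun _ hx => hx.2)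
    refine hqi (hinv ⟨hq, fun s => ?_⟩)
    refine hN.isClosed.mem_of_tendsto (hΦ.eval (tendsto_const_nhds.prodMk_nhds hqU)) ?_
    filter_upwards [hray, hlarge (-(s / ε))] with x hx hxs
    have hmem := hx (s / ε + t x) (by linarith)
    rwa [mul_add, mul_div_cancel₀ _ hε, hadd] at hmem

/-- being an isolated map is an open condition in the space `𝒞` of
triples (flow, map, flow) with the given isolating neighborhoods, in the
compact-open topology. -/
theorem isolatedMap_isOpen
    {Mα Mβ : Type*} [TopologicalSpace Mα] [TopologicalSpace Mβ]
    [T2Space Mα] [T2Space Mβ] [LocallyCompactSpace Mα] [LocallyCompactSpace Mβ]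
    (Nα : Set Mα) (Nβ : Set Mβ) (hNα : IsCompact Nα) (hNβ : IsCompact Nβ)
    (𝒞 : Set (ContinuousMap (ℝ × Mα) Mα × ContinuousMap Mα Mβ × ContinuousMap (ℝ × Mβ) Mβ))
    (h𝒞 : 𝒞 = {T | IsFlow (fun t x => T.1 (t, x)) ∧ IsFlow (fun t x => T.2.2 (t, x)) ∧
        IsIsolatingNbhd (fun t x => T.1 (t, x)) Nα ∧
        IsIsolatingNbhd (fun t x => T.2.2 (t, x)) Nβ})
    (T₀ : ContinuousMap (ℝ × Mα) Mα × ContinuousMap Mα Mβ × ContinuousMap (ℝ × Mβ) Mβ)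
    (hT₀ : T₀ ∈ 𝒞)
    (hiso : IsIsolatedMap (fun t x => T₀.1 (t, x)) (fun t x => T₀.2.2 (t, x)) Nα Nβ T₀.2.1) :
    ∃ A : Set 𝒞, IsOpen A ∧ (⟨T₀, hT₀⟩ : 𝒞) ∈ A ∧
      ∀ T ∈ A, IsIsolatedMap (fun t x => (T : ContinuousMap (ℝ × Mα) Mα ×
          ContinuousMap Mα Mβ × ContinuousMap (ℝ × Mβ) Mβ).1 (t, x))
        (fun t x => (T : ContinuousMap (ℝ × Mα) Mα ×
          ContinuousMap Mα Mβ × ContinuousMap (ℝ × Mβ) Mβ).2.2 (t, x)) Nα Nβ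
        (T : ContinuousMap (ℝ × Mα) Mα ×
          ContinuousMap Mα Mβ × ContinuousMap (ℝ × Mβ) Mβ).2.1 := by
  subst h𝒞
  let B : Set {T : C(ℝ × Mα, Mα) × C(Mα, Mβ) × C(ℝ × Mβ, Mβ) |
      IsFlow (fun t x => T.1 (t, x)) ∧ IsFlow (fun t x => T.2.2 (t, x)) ∧
        IsIsolatingNbhd (fun t x => T.1 (t, x)) Nα ∧
        IsIsolatingNbhd (fun t x => T.2.2 (t, x)) Nβ} :=
    {T | ¬ IsIsolatedMap (fun t x => T.1.1 (t, x)) (fun t x => T.1.2.2 (t, x)) Nα Nβ T.1.2.1}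
  refine ⟨(closure B)ᶜ, isClosed_closure.isOpen_compl, fun hcl => ?_,
    fun T hT => of_not_not fun hT' => hT (subset_closure hT')⟩
  have hne := mem_closure_iff_comap_neBot.1 hcl
  let U : Ultrafilter B := Ultrafilter.of (comap Subtype.val (𝓝 ⟨T₀, hT₀⟩))
  have hU : Tendsto (fun x : B => x.1.1) U (𝓝 T₀) :=
    (continuous_subtype_val.tendsto _).comp (tendsto_comap.mono_left (Ultrafilter.of_le _))
  have hΦα : Tendsto (fun x : B => x.1.1.1) U (𝓝 T₀.1) := (continuous_fst.tendsto _).comp hU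
  have hh : Tendsto (fun x : B => x.1.1.2.1) U (𝓝 T₀.2.1) :=
    ((continuous_fst.comp continuous_snd).tendsto _).comp hU
  have hΦβ : Tendsto (fun x : B => x.1.1.2.2) U (𝓝 T₀.2.2) :=
    ((continuous_snd.comp continuous_snd).tendsto _).comp hU
  have hbad (x : B) : ∃ p ∈ Nα, (∀ s ≥ (0 : ℝ), x.1.1.1 (-1 * s, p) ∈ Nα) ∧
      (∀ s ≥ (0 : ℝ), x.1.1.2.2 (1 * s, x.1.1.2.1 p) ∈ Nβ) ∧
      ((∃ s ≥ (0 : ℝ), x.1.1.1 (-1 * s, p) ∉ interior Nα) ∨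
        ∃ s ≥ (0 : ℝ), x.1.1.2.2 (1 * s, x.1.1.2.1 p) ∉ interior Nβ) := by
    by_contra! hx
    refine x.2 fun p hp hb hf => ?_
    have hx := hx p hp (fun s hs => hb ⟨_, by linarith, rfl⟩)
      (fun s hs => hf ⟨_, by linarith, rfl⟩)
    constructor
    · rintro _ ⟨t, ht, rfl⟩
      simpa using hx.1 (-t) (by linarith)
    · rintro _ ⟨t, ht, rfl⟩
      simpa using hx.2 t ht
  choose p hpN hback hfwd hout using hbad
  obtain ⟨p₀, hp₀, hpU⟩ := hNα.ultrafilter_le_nhds (U.map p)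
    (le_principal_iff.2 (Eventually.of_forall hpN : ∀ᶠ x in U, p x ∈ Nα))
  have hpU : Tendsto p U (𝓝 p₀) := hpU
  have hhU : Tendsto (fun x : B => x.1.1.2.1 (p x)) U (𝓝 (T₀.2.1 p₀)) := hh.eval hpU
  have hback₀ := ray_mem_of_tendsto hΦα hpU hNα.isClosed (-1) (.of_forall hback)
  have hfwd₀ := ray_mem_of_tendsto hΦβ hhU hNβ.isClosed 1 (.of_forall hfwd)
  obtain ⟨hiα, hiβ⟩ := hiso p₀ hp₀
    (by rintro _ ⟨t, ht, rfl⟩; simpa using hback₀ (-t) (by linarith))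
    (by rintro _ ⟨t, ht, rfl⟩; simpa using hfwd₀ t ht)
  rcases Ultrafilter.eventually_or.1 (Eventually.of_forall hout : ∀ᶠ x in U, _ ∨ _) with h | h
  · obtain ⟨s, hs, hsi⟩ := exists_ray_notMem_interior_of_tendsto hΦα
      (fun x => x.1.2.1.2.2) hpU hNα hT₀.2.2.1.2 (by norm_num) (.of_forall hback) h
    exact hsi (hiα ⟨_, by linarith, rfl⟩)
  · obtain ⟨s, hs, hsi⟩ := exists_ray_notMem_interior_of_tendsto hΦβ
      (fun x => x.1.2.2.1.2.2) hhU hNβ hT₀.2.2.2.2 one_ne_zero (.of_forall hfwd) h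
    exact hsi (hiβ ⟨_, by linarith, rfl⟩)
end

section
/- Let M_alpha, M_beta be topological spaces. Let phi_alpha : R x M_alpha x [0,1] -> M_alpha and phi_beta : R x M_beta x [0,1] -> M_beta be continuous maps such that for each lambda in [0,1] the slices phi_alpha_lambda := phi_alpha(·,·,lambda) and phi_beta_lambda are flows, and let h : M_alpha x [0,1] -> M_beta be continuous with h_lambda = h(·,lambda). Suppose N_alpha ⊆ M_alpha is an isolating neighborhood for phi_alpha_lambda for every lambda, and N_beta ⊆ M_beta is an isolating neighborhood for phi_beta_lambda for every lambda. Define Phi_alpha on M_alpha x [0,1] by Phi_alpha(t,(x,lambda)) = (phi_alpha(t,x,lambda), lambda), define Phi_beta analogously, and define H : M_alpha x [0,1] -> M_beta x [0,1] by H(x,lambda) = (h_lambda(x), lambda). Then Phi_alpha and Phi_beta are flows, N_alpha x [0,1] and N_beta x [0,1] are isolating neighborhoods for them, and H is an isolated map with respect to N_alpha x [0,1] and N_beta x [0,1] if and only if for every lambda in [0,1] the map h_lambda is an isolated map with respect to N_alpha and N_beta (for the flows phi_alpha_lambda, phi_beta_lambda). -/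
open Set

section ProductFlow

variable {M N L : Type*}

theorem IsFlow.prod_parameter [TopologicalSpace M] [TopologicalSpace L] {φ : ℝ → M → L → M}
    (hφc : Continuous fun q : ℝ × M × L => φ q.1 q.2.1 q.2.2)
    (hφ : ∀ l, IsFlow (fun t x => φ t x l)) :
    IsFlow (fun t (q : M × L) => (φ t q.1 q.2, q.2)) :=
  ⟨hφc.prodMk (continuous_snd.comp continuous_snd),
    fun q => Prod.ext ((hφ q.2).2.1 q.1) rfl,
    fun t s q => Prod.ext ((hφ q.2).2.2 t s q.1) rfl⟩

theorem IsIsolatingNbhd.prod_parameter [TopologicalSpace M] [TopologicalSpace L] [CompactSpace L]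
    [Nonempty L] {φ : ℝ → M → L → M} {A : Set M}
    (hA : ∀ l, IsIsolatingNbhd (fun t x => φ t x l) A) :
    IsIsolatingNbhd (fun t (q : M × L) => (φ t q.1 q.2, q.2)) (A ×ˢ (univ : Set L)) := by
  refine ⟨(hA (Classical.arbitrary L)).1.prod isCompact_univ, fun q hq => ?_⟩
  rw [interior_prod_eq, interior_univ]
  exact ⟨(hA q.2).2 ⟨hq.1.1, fun t => (hq.2 t).1⟩, mem_univ _⟩

theorem backOrbit_prod_subset_iff {φ : ℝ → M → L → M} {A : Set M} {q : M × L} :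
    backOrbit (fun t (q : M × L) => (φ t q.1 q.2, q.2)) q ⊆ A ×ˢ (univ : Set L) ↔
      backOrbit (fun t x => φ t x q.2) q.1 ⊆ A := by
  constructor
  · rintro h _ ⟨t, ht, rfl⟩
    exact (h ⟨t, ht, rfl⟩).1
  · rintro h _ ⟨t, ht, rfl⟩
    exact ⟨h ⟨t, ht, rfl⟩, mem_univ _⟩

theorem fwdOrbit_prod_subset_iff {φ : ℝ → M → L → M} {A : Set M} {q : M × L} :
    fwdOrbit (fun t (q : M × L) => (φ t q.1 q.2, q.2)) q ⊆ A ×ˢ (univ : Set L) ↔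
      fwdOrbit (fun t x => φ t x q.2) q.1 ⊆ A := by
  constructor
  · rintro h _ ⟨t, ht, rfl⟩
    exact (h ⟨t, ht, rfl⟩).1
  · rintro h _ ⟨t, ht, rfl⟩
    exact ⟨h ⟨t, ht, rfl⟩, mem_univ _⟩

theorem isIsolatedMap_prod_iff [TopologicalSpace M] [TopologicalSpace N] [TopologicalSpace L]
    {φ : ℝ → M → L → M} {ψ : ℝ → N → L → N} {A : Set M} {B : Set N} {h : M → L → N} :
    IsIsolatedMap (fun t (q : M × L) => (φ t q.1 q.2, q.2))
        (fun t (q : N × L) => (ψ t q.1 q.2, q.2)) (A ×ˢ (univ : Set L)) (B ×ˢ (univ : Set L))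
        (fun q : M × L => (h q.1 q.2, q.2)) ↔
      ∀ l, IsIsolatedMap (fun t x => φ t x l) (fun t x => ψ t x l) A B (fun x => h x l) := by
  simp only [IsIsolatedMap, interior_prod_eq, interior_univ, backOrbit_prod_subset_iff,
    fwdOrbit_prod_subset_iff]
  exact ⟨fun H l p hp => H (p, l) ⟨hp, mem_univ _⟩, fun H q hq => H q.2 q.1 hq.1⟩

end ProductFlow

/-- an isolated homotopy, viewed as a single map between the product
spaces `Mα × [0,1]` and `Mβ × [0,1]` with the product flows, is isolated with
respect to `Nα × [0,1]`, `Nβ × [0,1]` iff each slice is isolated. -/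
theorem isolatedHomotopy_iff_product_isolatedMap
    {Mα Mβ : Type*} [TopologicalSpace Mα] [TopologicalSpace Mβ]
    (φα : ℝ → Mα → unitInterval → Mα) (φβ : ℝ → Mβ → unitInterval → Mβ)
    (hφαc : Continuous fun q : ℝ × Mα × unitInterval => φα q.1 q.2.1 q.2.2)
    (hφβc : Continuous fun q : ℝ × Mβ × unitInterval => φβ q.1 q.2.1 q.2.2)
    (hφα : ∀ l : unitInterval, IsFlow (fun t x => φα t x l))
    (hφβ : ∀ l : unitInterval, IsFlow (fun t x => φβ t x l))
    (h : Mα → unitInterval → Mβ)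
    (hc : Continuous fun q : Mα × unitInterval => h q.1 q.2)
    (Nα : Set Mα) (Nβ : Set Mβ)
    (hNα : ∀ l : unitInterval, IsIsolatingNbhd (fun t x => φα t x l) Nα)
    (hNβ : ∀ l : unitInterval, IsIsolatingNbhd (fun t x => φβ t x l) Nβ) :
    IsFlow (fun t (q : Mα × unitInterval) => (φα t q.1 q.2, q.2)) ∧
    IsFlow (fun t (q : Mβ × unitInterval) => (φβ t q.1 q.2, q.2)) ∧
    IsIsolatingNbhd (fun t (q : Mα × unitInterval) => (φα t q.1 q.2, q.2))
      (Nα ×ˢ (Set.univ : Set unitInterval)) ∧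
    IsIsolatingNbhd (fun t (q : Mβ × unitInterval) => (φβ t q.1 q.2, q.2))
      (Nβ ×ˢ (Set.univ : Set unitInterval)) ∧
    (IsIsolatedMap (fun t (q : Mα × unitInterval) => (φα t q.1 q.2, q.2))
        (fun t (q : Mβ × unitInterval) => (φβ t q.1 q.2, q.2))
        (Nα ×ˢ (Set.univ : Set unitInterval)) (Nβ ×ˢ (Set.univ : Set unitInterval))
        (fun q : Mα × unitInterval => (h q.1 q.2, q.2)) ↔
      ∀ l : unitInterval,
        IsIsolatedMap (fun t x => φα t x l) (fun t x => φβ t x l) Nα Nβ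
          (fun x => h x l)) := by
  exact ⟨.prod_parameter hφαc hφα, .prod_parameter hφβc hφβ, .prod_parameter hNα,
    .prod_parameter hNβ, isIsolatedMap_prod_iff⟩
end
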